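/- Cyclic covariance of the renormalised Bethe vector: for every N ≥ 2 and all nonzero complex w₁,…,w_N with q w_j/w_k ∉ {1,−1} for all j ≠ k, S' |Ψ̃(w₁,…,w_{N−1},w_N)⟩ = (−1)^{N+1} |Ψ̃(w_N,w₁,…,w_{N−1})⟩, where S' is the twisted translation operator for twist angle φ = π. -/

import Mathlib

open Matrix BigOperators Finset

noncomputable section

/-- `[z] = z - z⁻¹`. -/
def br (z : ℂ) : ℂ := z - z⁻¹

/-- R-matrix `R^{(1,2)}(z)` on ℂ²⊗ℂ³; basis `(ε, σ)` with ε ∈ {0=↑,1=↓}, σ ∈ {0=⇑,1=0,2=⇓}. -/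
def R12 (q c z : ℂ) : Matrix (Fin 2 × Fin 3) (Fin 2 × Fin 3) ℂ :=
  Matrix.of fun p p' =>
    if p = (0,0) ∧ p' = (0,0) then br (q^2*z)
    else if p = (0,1) ∧ p' = (0,1) then br (q*z)
    else if p = (0,2) ∧ p' = (0,2) then br z
    else if p = (1,0) ∧ p' = (1,0) then br z
    else if p = (1,1) ∧ p' = (1,1) then br (q*z)
    else if p = (1,2) ∧ p' = (1,2) then br (q^2*z)
    else if p = (0,1) ∧ p' = (1,0) then c
    else if p = (0,2) ∧ p' = (1,1) then c
    else if p = (1,0) ∧ p' = (0,1) then c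
    else if p = (1,1) ∧ p' = (0,2) then c
    else 0

/-- `R^{(1,2)}` acting on the auxiliary ℂ² and the j-th site of `(ℂ³)^{⊗N}`. -/
def R12at (q c z : ℂ) {N : ℕ} (j : Fin N) :
    Matrix (Fin 2 × (Fin N → Fin 3)) (Fin 2 × (Fin N → Fin 3)) ℂ :=
  Matrix.of fun p p' =>
    R12 q c z (p.1, p.2 j) (p'.1, p'.2 j) *
      if ∀ k, k ≠ j → p.2 k = p'.2 k then 1 else 0

/-- Monodromy matrix `𝒯_a(z) = R^{(1,2)}_{a,N}(q⁻¹z/w_N) ⋯ R^{(1,2)}_{a,1}(q⁻¹z/w₁)`. -/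
def monodromy (q c : ℂ) {N : ℕ} (w : Fin N → ℂ) (z : ℂ) :
    Matrix (Fin 2 × (Fin N → Fin 3)) (Fin 2 × (Fin N → Fin 3)) ℂ :=
  (((List.finRange N).reverse).map fun j => R12at q c (q⁻¹ * z / w j) j).prod

/-- The operator 𝒜(z): auxiliary block (↑,↑) of the monodromy matrix. -/
def Aop (q c : ℂ) {N : ℕ} (w : Fin N → ℂ) (z : ℂ) :
    Matrix (Fin N → Fin 3) (Fin N → Fin 3) ℂ :=
  Matrix.of fun σ τ => monodromy q c w z (0, σ) (0, τ)

/-- The operator ℬ(z): auxiliary block (↑,↓) of the monodromy matrix. -/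
def Bop (q c : ℂ) {N : ℕ} (w : Fin N → ℂ) (z : ℂ) :
    Matrix (Fin N → Fin 3) (Fin N → Fin 3) ℂ :=
  Matrix.of fun σ τ => monodromy q c w z (0, σ) (1, τ)

/-- The operator 𝒟(z): auxiliary block (↓,↓) of the monodromy matrix. -/
def Dop (q c : ℂ) {N : ℕ} (w : Fin N → ℂ) (z : ℂ) :
    Matrix (Fin N → Fin 3) (Fin N → Fin 3) ℂ :=
  Matrix.of fun σ τ => monodromy q c w z (1, σ) (1, τ)

/-- Bethe reference state `|∧⟩ = |⇑…⇑⟩`. -/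
def vac (N : ℕ) : (Fin N → Fin 3) → ℂ := fun σ => if σ = fun _ => 0 then 1 else 0

/-- Bethe vector `|Ψ(w₁,…,w_N)⟩ = ℬ(w₁)⋯ℬ(w_N)|∧⟩`. -/
def bethe (q c : ℂ) {N : ℕ} (w : Fin N → ℂ) : (Fin N → Fin 3) → ℂ :=
  (((List.finRange N).map fun j => Bop q c w (w j)).prod).mulVec (vac N)

/-- Renormalised Bethe vector
`|Ψ̃(w₁,…,w_N)⟩ = c^{−N} (∏_{j<k} [q w_j/w_k])⁻¹ |Ψ(w₁,…,w_N)⟩`. -/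
def betheTilde (q c : ℂ) {N : ℕ} (w : Fin N → ℂ) : (Fin N → Fin 3) → ℂ :=
  ((c ^ N)⁻¹ *
    (∏ pr ∈ Finset.univ.filter (fun pr : Fin N × Fin N => pr.1 < pr.2),
      br (q * w pr.1 / w pr.2))⁻¹) • bethe q c w

/-- Twisted translation operator `S'` with diagonal twist `d`:
`S'(v₁⊗…⊗v_N) = (Ω v_N)⊗v₁⊗…⊗v_{N−1}` where `Ω = diag d`. -/
def Sprime (N : ℕ) (d : Fin 3 → ℂ) : Matrix (Fin N → Fin 3) (Fin N → Fin 3) ℂ :=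
  Matrix.of fun σ τ =>
    if τ = fun j => σ (finRotate N j) then
      ∏ j : Fin N, (if (finRotate N j : Fin N).val = 0 then d (τ j) else 1)
    else 0

section Exchange
variable {A A' : Type*} [Ring A] [Algebra ℂ A] [Ring A'] [Algebra ℂ A']

/-- The spin-1/2 (six-vertex) R-matrix on the two auxiliary spaces. -/
def sixVertex (q x : ℂ) : Matrix (Fin 2 × Fin 2) (Fin 2 × Fin 2) ℂ :=
  Matrix.of fun p p' =>
    if p = p' then (if p.1 = p.2 then br (q * x) else br x)
    else if p.1 = p'.2 ∧ p.2 = p'.1 then br q else 0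

/-- The exchange relation `r X₁ Y₂ = Y₂ X₁ r` between two matrices with entries in an algebra. -/
def Exchange (r : Matrix (Fin 2 × Fin 2) (Fin 2 × Fin 2) ℂ) (X Y : Matrix (Fin 2) (Fin 2) A) :
    Prop :=
  ∀ i j k l : Fin 2, ∑ m, ∑ n, r (i, j) (m, n) • (X m k * Y n l) =
    ∑ m, ∑ n, r (m, n) (k, l) • (Y j n * X i m)

theorem Exchange.map {r : Matrix (Fin 2 × Fin 2) (Fin 2 × Fin 2) ℂ}
    {X Y : Matrix (Fin 2) (Fin 2) A} (h : Exchange r X Y) (φ : A →ₐ[ℂ] A') :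
    Exchange r (X.map φ) (Y.map φ) := fun i j k l => by
  simpa using congrArg φ (h i j k l)

theorem Exchange.one (r : Matrix (Fin 2 × Fin 2) (Fin 2 × Fin 2) ℂ) :
    Exchange r (1 : Matrix (Fin 2) (Fin 2) A) 1 := fun i j k l => by
  simp [Matrix.one_apply]

theorem Exchange.mul {r : Matrix (Fin 2 × Fin 2) (Fin 2 × Fin 2) ℂ}
    {X X' Y Y' : Matrix (Fin 2) (Fin 2) A} (h : Exchange r X Y) (h' : Exchange r X' Y')
    (hXY : ∀ i j k l, Commute (X i j) (Y' k l)) (hYX : ∀ i j k l, Commute (Y i j) (X' k l)) :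
    Exchange r (X * X') (Y * Y') := fun i j k l => by
  have e1 : ∀ m n, (X * X') m k * (Y * Y') n l =
      ∑ p, ∑ s, (X m p * Y n s) * (X' p k * Y' s l) := fun m n => by
    simp only [Matrix.mul_apply, Finset.sum_mul_sum]
    refine Finset.sum_congr rfl fun p _ => Finset.sum_congr rfl fun s _ => ?_
    rw [mul_assoc, mul_assoc, ← mul_assoc (X' p k), ← (hYX n s p k).eq, mul_assoc]
  have e2 : ∀ m n, (Y * Y') j n * (X * X') i m =
      ∑ p, ∑ s, (Y j s * X i p) * (Y' s n * X' p m) := fun m n => by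
    simp only [Matrix.mul_apply, Finset.sum_mul_sum]
    rw [Finset.sum_comm]
    refine Finset.sum_congr rfl fun p _ => Finset.sum_congr rfl fun s _ => ?_
    rw [mul_assoc, mul_assoc, ← mul_assoc (Y' s n), ← (hXY i p s n).eq, mul_assoc]
  have e3 : ∀ p s, (∑ m, ∑ n, r (i, j) (m, n) • (X m p * Y n s)) * (X' p k * Y' s l) =
      (∑ m, ∑ n, r (m, n) (p, s) • (Y j n * X i m)) * (X' p k * Y' s l) :=
    fun p s => by rw [h i j p s]
  have e4 : ∀ p s, (Y j s * X i p) * (∑ m, ∑ n, r (p, s) (m, n) • (X' m k * Y' n l)) =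
      (Y j s * X i p) * (∑ m, ∑ n, r (m, n) (k, l) • (Y' s n * X' p m)) :=
    fun p s => by rw [h' p s k l]
  simp only [e1, e2]
  simp only [Fin.sum_univ_two, smul_add, add_mul, mul_add, smul_mul_assoc, mul_smul_comm]
    at e3 e4 ⊢
  have a1 := e3 0 0
  have a2 := e3 0 1
  have a3 := e3 1 0
  have a4 := e3 1 1
  have b1 := e4 0 0
  have b2 := e4 0 1
  have b3 := e4 1 0
  have b4 := e4 1 1
  clear e1 e2 e3 e4
  simp only [mul_assoc] at *
  linear_combination (norm := module) a1 + a2 + a3 + a4 + b1 + b2 + b3 + b4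

end Exchange

/-- `R12` as a `2 × 2` matrix of operators on one spin-one site. -/
def localL (q c z : ℂ) : Matrix (Fin 2) (Fin 2) (Matrix (Fin 3) (Fin 3) ℂ) :=
  !![!![br (q ^ 2 * z), 0, 0; 0, br (q * z), 0; 0, 0, br z], !![0, 0, 0; c, 0, 0; 0, c, 0];
    !![0, c, 0; 0, 0, c; 0, 0, 0], !![br z, 0, 0; 0, br (q * z), 0; 0, 0, br (q ^ 2 * z)]]

theorem R12_eq_localL (q c z : ℂ) (i j : Fin 2) (x y : Fin 3) :
    R12 q c z (i, x) (j, y) = localL q c z i j x y := by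
  fin_cases i <;> fin_cases j <;> fin_cases x <;> fin_cases y <;> simp [R12, localL]

theorem exchange_localL {q c : ℂ} (hq : q ≠ 0) (hc : c ^ 2 = br q * br (q ^ 2)) {x y : ℂ}
    (hx : x ≠ 0) (hy : y ≠ 0) :
    Exchange (sixVertex q (x / y)) (localL q c x) (localL q c y) := by
  have hc' : c * c = br q * br (q ^ 2) := by rw [← hc, sq]
  intro i j k l
  fin_cases i <;> fin_cases j <;> fin_cases k <;> fin_cases l <;>
    simp [Fin.sum_univ_two, sixVertex, localL, hc'] <;> simp only [br] <;>
    (repeat' apply And.intro) <;>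
    first
    | exact Or.inl (mul_comm _ _)
    | (ext i; fin_cases i <;> rfl)
    | (field_simp; ring)

section Sites
variable {N : ℕ}

/-- The one-site operator `m` acting on site `j`, as a matrix. -/
def siteOp (j : Fin N) (m : Matrix (Fin 3) (Fin 3) ℂ) :
    Matrix (Fin N → Fin 3) (Fin N → Fin 3) ℂ :=
  Matrix.of fun σ τ => m (σ j) (τ j) * if ∀ k, k ≠ j → σ k = τ k then 1 else 0

theorem siteOp_mulVec (j : Fin N) (m : Matrix (Fin 3) (Fin 3) ℂ) (v : (Fin N → Fin 3) → ℂ)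
    (σ : Fin N → Fin 3) :
    (siteOp j m *ᵥ v) σ = ∑ y, m (σ j) y * v (Function.update σ j y) := by
  rw [Matrix.mulVec, dotProduct]
  symm
  refine Finset.sum_of_injOn (fun y => Function.update σ j y)
    ((Function.update_injective σ j).injOn) (by simp) (fun τ _ hτ => ?_) (fun y _ => ?_)
  · simp only [siteOp, Matrix.of_apply]
    rw [if_neg, mul_zero, zero_mul]
    intro h
    refine hτ ⟨τ j, by simp, ?_⟩
    funext k
    by_cases hk : k = j
    · subst hk; simp
    · simp [hk, h k hk]
  · simp only [siteOp, Matrix.of_apply, Function.update_self]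
    rw [if_pos, mul_one]
    intro k hk
    simp [hk]

/-- The embedding of one-site operators at site `j`. -/
def siteHom (j : Fin N) :
    Matrix (Fin 3) (Fin 3) ℂ →ₐ[ℂ] Matrix (Fin N → Fin 3) (Fin N → Fin 3) ℂ :=
  AlgHom.ofLinearMap
    { toFun := siteOp j
      map_add' := fun a b => by
        ext
        simp only [siteOp, Matrix.of_apply, Matrix.add_apply, add_mul]
      map_smul' := fun a b => by ext; simp [siteOp] }
    (by
      refine Matrix.mulVec_injective ?_
      funext v σ
      simp [siteOp_mulVec, Matrix.one_apply])
    (fun a b => by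
      refine Matrix.mulVec_injective ?_
      funext v σ
      simp only [LinearMap.coe_mk, AddHom.coe_mk, ← Matrix.mulVec_mulVec, siteOp_mulVec,
        Matrix.mul_apply, Function.update_self, Function.update_idem, Finset.sum_mul,
        Finset.mul_sum, mul_assoc]
      exact Finset.sum_comm)

theorem siteHom_apply (j : Fin N) (m : Matrix (Fin 3) (Fin 3) ℂ) (σ τ : Fin N → Fin 3) :
    siteHom j m σ τ = m (σ j) (τ j) * if ∀ k, k ≠ j → σ k = τ k then 1 else 0 := rfl

theorem siteHom_mulVec (j : Fin N) (m : Matrix (Fin 3) (Fin 3) ℂ) (v : (Fin N → Fin 3) → ℂ)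
    (σ : Fin N → Fin 3) :
    (siteHom j m *ᵥ v) σ = ∑ y, m (σ j) y * v (Function.update σ j y) :=
  siteOp_mulVec j m v σ

theorem siteHom_mul_apply (j : Fin N) (m : Matrix (Fin 3) (Fin 3) ℂ)
    (M : Matrix (Fin N → Fin 3) (Fin N → Fin 3) ℂ) (σ τ : Fin N → Fin 3) :
    (siteHom j m * M) σ τ = ∑ y, m (σ j) y * M (Function.update σ j y) τ :=
  siteOp_mulVec j m (fun ρ => M ρ τ) σ

theorem commute_siteHom {j k : Fin N} (h : j ≠ k) (m m' : Matrix (Fin 3) (Fin 3) ℂ) :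
    Commute (siteHom j m) (siteHom k m') := by
  refine Matrix.mulVec_injective ?_
  funext v σ
  simp only [← Matrix.mulVec_mulVec, siteHom_mulVec, Function.update_of_ne h,
    Function.update_of_ne h.symm, Finset.mul_sum]
  rw [Finset.sum_comm]
  refine Finset.sum_congr rfl fun y _ => Finset.sum_congr rfl fun y' _ => ?_
  rw [Function.update_comm h]
  ring

/-- The monodromy matrix over a list of sites, as a `2 × 2` matrix of operators. -/
def monoT (q c : ℂ) (w : Fin N → ℂ) (z : ℂ) (l : List (Fin N)) :
    Matrix (Fin 2) (Fin 2) (Matrix (Fin N → Fin 3) (Fin N → Fin 3) ℂ) :=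
  (l.map fun j => (localL q c (q⁻¹ * z / w j)).map (siteHom j)).prod

variable {q c : ℂ} {w : Fin N → ℂ}

theorem monoT_nil (z : ℂ) : monoT q c w z [] = 1 := rfl

theorem monoT_cons (z : ℂ) (a : Fin N) (l : List (Fin N)) :
    monoT q c w z (a :: l) = (localL q c (q⁻¹ * z / w a)).map (siteHom a) * monoT q c w z l := by
  simp [monoT]

theorem monoT_concat (z : ℂ) (a : Fin N) (l : List (Fin N)) :
    monoT q c w z (l ++ [a]) =
      monoT q c w z l * (localL q c (q⁻¹ * z / w a)).map (siteHom a) := by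
  simp [monoT]

theorem monodromy_eq_monoT (z : ℂ) (i j : Fin 2) (σ τ : Fin N → Fin 3) :
    monodromy q c w z (i, σ) (j, τ) = monoT q c w z (List.finRange N).reverse i j σ τ := by
  have h : (Matrix.compRingEquiv (Fin 2) (Fin N → Fin 3) ℂ)
      (monoT q c w z (List.finRange N).reverse) = monodromy q c w z := by
    rw [monoT, monodromy, map_list_prod, List.map_map]
    congr 2
    funext k
    ext ⟨i, σ⟩ ⟨j, τ⟩
    simp only [R12at, Matrix.of_apply, R12_eq_localL]
    rfl
  rw [← h]
  rfl

theorem commute_monoT {a : Fin N} {l : List (Fin N)} (ha : a ∉ l) (z : ℂ)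
    (m : Matrix (Fin 3) (Fin 3) ℂ) (i j : Fin 2) :
    Commute (siteHom a m) (monoT q c w z l i j) := by
  induction l generalizing i j with
  | nil =>
    rw [monoT_nil, Matrix.one_apply]
    split_ifs
    · exact Commute.one_right _
    · exact Commute.zero_right _
  | cons b l ih =>
    rw [List.mem_cons, not_or] at ha
    rw [monoT_cons, Matrix.mul_apply]
    exact Commute.sum_right _ _ _ fun p _ =>
      (commute_siteHom ha.1 _ _).mul_right (ih ha.2 p j)

theorem exchange_monoT (hq : q ≠ 0) (hc : c ^ 2 = br q * br (q ^ 2)) (hw : ∀ j, w j ≠ 0)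
    {x y : ℂ} (hx : x ≠ 0) (hy : y ≠ 0) {l : List (Fin N)} (hl : l.Nodup) :
    Exchange (sixVertex q (x / y)) (monoT q c w x l) (monoT q c w y l) := by
  induction l with
  | nil => exact Exchange.one _
  | cons a l ih =>
    rw [List.nodup_cons] at hl
    rw [monoT_cons, monoT_cons]
    refine Exchange.mul ?_ (ih hl.2) (fun i j k l => commute_monoT hl.1 _ _ _ _)
      (fun i j k l => commute_monoT hl.1 _ _ _ _)
    have e : x / y = (q⁻¹ * x / w a) / (q⁻¹ * y / w a) := by
      have := hw a
      field_simp
    rw [e]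
    have := hw a
    exact (exchange_localL hq hc (by positivity) (by positivity)).map (siteHom a)

theorem sixVertex_BB {A : Type*} [Ring A] [Algebra ℂ A] {x : ℂ} {X Y : Matrix (Fin 2) (Fin 2) A}
    (h : Exchange (sixVertex q x) X Y) :
    br (q * x) • (X 0 1 * Y 0 1) = br (q * x) • (Y 0 1 * X 0 1) := by
  simpa [Fin.sum_univ_two, sixVertex] using h 0 0 1 1

theorem sixVertex_AB {A : Type*} [Ring A] [Algebra ℂ A] {x : ℂ} {X Y : Matrix (Fin 2) (Fin 2) A}
    (h : Exchange (sixVertex q x) X Y) :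
    br (q * x) • (X 0 1 * Y 0 0) = br q • (Y 0 1 * X 0 0) + br x • (Y 0 0 * X 0 1) := by
  simpa [Fin.sum_univ_two, sixVertex] using h 0 0 1 0

theorem sixVertex_DB {A : Type*} [Ring A] [Algebra ℂ A] {x : ℂ} {X Y : Matrix (Fin 2) (Fin 2) A}
    (h : Exchange (sixVertex q x) X Y) :
    br q • (X 0 1 * Y 1 1) + br x • (X 1 1 * Y 0 1) = br (q * x) • (Y 0 1 * X 1 1) := by
  simpa [Fin.sum_univ_two, sixVertex] using h 1 0 1 1

end Sites

section Brackets

theorem br_inv (z : ℂ) : br z⁻¹ = -br z := by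
  simp [br]

theorem br_one : br 1 = 0 := by
  simp [br]

theorem br_eq_zero_iff {z : ℂ} (hz : z ≠ 0) : br z = 0 ↔ z ^ 2 = 1 := by
  rw [br, sub_eq_zero, ← mul_left_inj' hz, inv_mul_cancel₀ hz, sq]

theorem br_div_swap (x y : ℂ) : br (x / y) = -br (y / x) := by
  rw [← br_inv, inv_div]

theorem br_inv_mul_div (q x y : ℂ) : br (q⁻¹ * x / y) = -br (q * y / x) := by
  rw [← br_inv]
  congr 1
  simp [div_eq_mul_inv]
  ring

theorem br_mul_div {q x y : ℂ} (hq : q ≠ 0) (hx : x ≠ 0) (hy : y ≠ 0) :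
    br (q * (x / y)) = (q ^ 2 * x ^ 2 - y ^ 2) / (q * x * y) := by
  rw [br]
  field_simp

theorem br_div {x y : ℂ} (hx : x ≠ 0) (hy : y ≠ 0) :
    br (x / y) = (x ^ 2 - y ^ 2) / (x * y) := by
  simpa using br_mul_div one_ne_zero hx hy

theorem sq_sub_sq_ne_zero_of_br {x y : ℂ} (hx : x ≠ 0) (hy : y ≠ 0) (h : br (x / y) ≠ 0) :
    x ^ 2 - y ^ 2 ≠ 0 := by
  rw [br_div hx hy] at h
  exact (div_ne_zero_iff.1 h).1

/-- The consistency relation between the coefficients of the exchange relations. -/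
theorem exchange_coeff_identity {q x y z : ℂ} (hq : q ≠ 0) (hx : x ≠ 0) (hy : y ≠ 0)
    (hz : z ≠ 0) (hxy : br (x / y) ≠ 0) (hxz : br (x / z) ≠ 0) (hyz : br (y / z) ≠ 0) :
    br (q * (x / y)) / br (x / y) * (-br q / br (x / z)) +
        -br q / br (x / y) * (-br q / br (y / z)) =
      -br q / br (x / z) * (br (q * (z / y)) / br (z / y)) := by
  have h1 := sq_sub_sq_ne_zero_of_br hx hy hxy
  have h2 := sq_sub_sq_ne_zero_of_br hx hz hxz
  have h3 := sq_sub_sq_ne_zero_of_br hy hz hyz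
  have h4 : z ^ 2 - y ^ 2 ≠ 0 := fun h => h3 (by linear_combination -h)
  rw [br_mul_div hq hx hy, br_mul_div hq hz hy, br_div hx hy, br_div hx hz, br_div hy hz,
    br_div hz hy, br]
  field_simp
  ring

end Brackets

section OffShell
variable {A : Type*} [Ring A] [Algebra ℂ A] {ι : Type*} [DecidableEq ι]

/-- The action of an operator `T` obeying a quadratic exchange relation with the creation
operators `B` on a product of creation operators applied to an eigenvector of `T`. -/
theorem off_shell {T B : ℂ → A} {f g : ℂ → ℂ → ℂ} {t : ℂ → ℂ} {w : ι → ℂ} {P : Finset ι → A}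
    {u : Finset ι}
    (hP : ∀ i ∈ u, ∀ s ⊆ u, i ∉ s → P (insert i s) = B (w i) * P s)
    (hT : ∀ x, T x * P ∅ = t x • P ∅)
    (hTB : ∀ x y, x ≠ 0 → y ≠ 0 → br (x / y) ≠ 0 →
      T x * B y = f x y • (B y * T x) + g x y • (B x * T y))
    (hB : ∀ x y, x ≠ 0 → y ≠ 0 → Commute (B x) (B y))
    (hfg : ∀ x y z, x ≠ 0 → y ≠ 0 → z ≠ 0 → br (x / y) ≠ 0 → br (x / z) ≠ 0 → br (y / z) ≠ 0 →
      f x y * g x z + g x y * g y z = g x z * f z y)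
    (hw : ∀ j, w j ≠ 0) (hu : ∀ i ∈ u, ∀ j ∈ u, i ≠ j → br (w i / w j) ≠ 0)
    {s : Finset ι} (hs : s ⊆ u) {z : ℂ} (hz : z ≠ 0) (hzs : ∀ j ∈ s, br (z / w j) ≠ 0) :
    T z * P s = (t z * ∏ j ∈ s, f z (w j)) • P s +
      ∑ j ∈ s, (g z (w j) * (t (w j) * ∏ k ∈ s.erase j, f (w j) (w k))) •
        (B z * P (s.erase j)) := by
  induction s using Finset.induction_on generalizing z with
  | empty => simp [hT]
  | insert i s hi ih =>
    have hiu : i ∈ u := hs (Finset.mem_insert_self i s)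
    have hsu : s ⊆ u := (Finset.subset_insert i s).trans hs
    have hzi := hzs i (Finset.mem_insert_self i s)
    have hzj : ∀ j ∈ s, br (z / w j) ≠ 0 := fun j hj => hzs j (Finset.mem_insert_of_mem hj)
    have hne : ∀ j ∈ s, i ≠ j := fun j hj h => hi (h ▸ hj)
    have hij : ∀ j ∈ s, br (w i / w j) ≠ 0 := fun j hj => hu i hiu j (hsu hj) (hne j hj)
    rw [hP i hiu s hsu hi, ← mul_assoc, hTB z (w i) hz (hw i) hzi, add_mul, smul_mul_assoc,
      smul_mul_assoc, mul_assoc, mul_assoc, ih hsu hz hzj, ih hsu (hw i) hij,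
      Finset.prod_insert hi, Finset.sum_insert hi, Finset.erase_insert hi, mul_add, mul_add,
      smul_add, smul_add, mul_smul_comm, mul_smul_comm, Finset.mul_sum, Finset.mul_sum]
    have key : ∑ j ∈ s, (g z (w j) * (t (w j) * ∏ k ∈ (insert i s).erase j, f (w j) (w k))) •
          (B z * P ((insert i s).erase j)) =
        f z (w i) • ∑ j ∈ s, B (w i) *
            ((g z (w j) * (t (w j) * ∏ k ∈ s.erase j, f (w j) (w k))) •
              (B z * P (s.erase j))) +
          g z (w i) • ∑ j ∈ s, B z *
            ((g (w i) (w j) * (t (w j) * ∏ k ∈ s.erase j, f (w j) (w k))) •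
              (B (w i) * P (s.erase j))) := by
      rw [Finset.smul_sum, Finset.smul_sum, ← Finset.sum_add_distrib]
      refine Finset.sum_congr rfl fun j hj => ?_
      have hie : i ∉ s.erase j := fun h => hi (Finset.mem_of_mem_erase h)
      rw [Finset.erase_insert_of_ne (hne j hj), Finset.prod_insert hie,
        hP i hiu _ ((Finset.erase_subset j s).trans hsu) hie, mul_smul_comm, mul_smul_comm,
        ← mul_assoc (B (w i)), (hB (w i) z (hw i) hz).eq, mul_assoc, smul_smul, smul_smul,
        ← add_smul]
      congr 1
      have := hfg z (w i) (w j) hz (hw i) (hw j) hzi (hzj j hj) (hij j hj)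
      linear_combination -(t (w j) * ∏ k ∈ s.erase j, f (w j) (w k)) * this
    rw [key, smul_smul, smul_smul]
    module

end OffShell

section Transfer
variable {N : ℕ} {q c : ℂ} {w : Fin N → ℂ}

/-- `Q` maps into the vectors that have highest weight at all sites of `l`. -/
def IsVac (l : List (Fin N)) (Q : Matrix (Fin N → Fin 3) (Fin N → Fin 3) ℂ) : Prop :=
  ∀ j ∈ l, ∀ m : Matrix (Fin 3) (Fin 3) ℂ, m 1 0 = 0 → m 2 0 = 0 →
    siteHom j m * Q = m 0 0 • Q

theorem monoT_mul_vac {l : List (Fin N)} (hl : l.Nodup)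
    {Q : Matrix (Fin N → Fin 3) (Fin N → Fin 3) ℂ} (hQ : IsVac l Q) (z : ℂ) :
    monoT q c w z l 0 0 * Q = (l.map fun j => br (q ^ 2 * (q⁻¹ * z / w j))).prod • Q ∧
      monoT q c w z l 1 0 * Q = 0 ∧
      monoT q c w z l 1 1 * Q = (l.map fun j => br (q⁻¹ * z / w j)).prod • Q := by
  induction l with
  | nil => simp [monoT_nil]
  | cons a l ih =>
    rw [List.nodup_cons] at hl
    obtain ⟨hA, hC, hD⟩ := ih hl.2 fun j hj => hQ j (List.mem_cons_of_mem a hj)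
    have ha := hQ a List.mem_cons_self
    have hα := ha (localL q c (q⁻¹ * z / w a) 0 0) (by simp [localL]) (by simp [localL])
    have hγ := ha (localL q c (q⁻¹ * z / w a) 1 0) (by simp [localL]) (by simp [localL])
    have hδ := ha (localL q c (q⁻¹ * z / w a) 1 1) (by simp [localL]) (by simp [localL])
    have hγ0 : localL q c (q⁻¹ * z / w a) 1 0 0 0 = 0 := by simp [localL]
    have hα0 : localL q c (q⁻¹ * z / w a) 0 0 0 0 = br (q ^ 2 * (q⁻¹ * z / w a)) := by
      simp [localL]
    have hδ0 : localL q c (q⁻¹ * z / w a) 1 1 0 0 = br (q⁻¹ * z / w a) := by simp [localL]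
    rw [hγ0, zero_smul] at hγ
    rw [hα0] at hα
    rw [hδ0] at hδ
    simp only [monoT_cons, Matrix.mul_apply, Fin.sum_univ_two, Matrix.map_apply, add_mul,
      mul_assoc, hA, hC, hD, mul_zero, add_zero, mul_smul_comm, hα, hγ, hδ, smul_zero,
      List.map_cons, List.prod_cons, smul_smul]
    refine ⟨by rw [mul_comm], trivial, ?_⟩
    rw [← mul_assoc, (commute_monoT hl.1 z _ 0 1).eq, mul_assoc, hγ, mul_zero, zero_add, mul_comm]

theorem commute_B (hq : q ≠ 0) (hq4 : q ^ 4 ≠ 1) (hc : c ^ 2 = br q * br (q ^ 2))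
    (hw : ∀ j, w j ≠ 0) {x y : ℂ} (hx : x ≠ 0) (hy : y ≠ 0) {l : List (Fin N)} (hl : l.Nodup) :
    Commute (monoT q c w x l 0 1) (monoT q c w y l 0 1) := by
  by_cases h : br (q * (x / y)) = 0
  · by_cases h' : br (q * (y / x)) = 0
    · rw [br_eq_zero_iff (by positivity)] at h h'
      refine absurd ?_ hq4
      calc q ^ 4 = (q * (x / y)) ^ 2 * (q * (y / x)) ^ 2 := by field_simp
        _ = 1 := by rw [h, h', one_mul]
    · exact (smul_right_injective _ h' (sixVertex_BB (exchange_monoT hq hc hw hy hx hl))).symm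
  · exact smul_right_injective _ h (sixVertex_BB (exchange_monoT hq hc hw hx hy hl))

/-- The Bethe vector whose roots are the inhomogeneities is annihilated by the transfer matrix
with a diagonal twist of angle `π`. -/
theorem transfer_mul_bethe (hq : q ≠ 0) (hq4 : q ^ 4 ≠ 1) (hc : c ^ 2 = br q * br (q ^ 2))
    (hw : ∀ j, w j ≠ 0) {l : List (Fin N)} (hl : l.Nodup)
    {Q : Matrix (Fin N → Fin 3) (Fin N → Fin 3) ℂ} (hQ : IsVac l Q)
    (hu : ∀ i ∈ l, ∀ j ∈ l, i ≠ j → br (w i / w j) ≠ 0)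
    {z : ℂ} (hz : z ≠ 0) (hzl : ∀ j ∈ l, br (z / w j) ≠ 0) :
    monoT q c w z l 0 0 * ((l.map fun j => monoT q c w (w j) l 0 1).prod * Q) =
      monoT q c w z l 1 1 * ((l.map fun j => monoT q c w (w j) l 0 1).prod * Q) := by
  have hcomm : ∀ s : Finset (Fin N), (s : Set (Fin N)).Pairwise
      (Function.onFun Commute fun j => monoT q c w (w j) l 0 1) :=
    fun s i _ j _ _ => commute_B hq hq4 hc hw (hw i) (hw j) hl
  let P : Finset (Fin N) → Matrix (Fin N → Fin 3) (Fin N → Fin 3) ℂ :=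
    fun s => s.noncommProd (fun j => monoT q c w (w j) l 0 1) (hcomm s) * Q
  have hP0 : P ∅ = Q := by simp [P]
  have hPl : (l.map fun j => monoT q c w (w j) l 0 1).prod * Q = P l.toFinset := by
    simp only [P]
    rw [Finset.noncommProd_toFinset _ _ _ hl]
  have hP : ∀ i ∈ l.toFinset, ∀ s ⊆ l.toFinset, i ∉ s →
      P (insert i s) = monoT q c w (w i) l 0 1 * P s := fun i _ s _ hi => by
    simp only [P]
    rw [Finset.noncommProd_insert_of_notMem _ _ _ _ hi, mul_assoc]
  have hu' : ∀ i ∈ l.toFinset, ∀ j ∈ l.toFinset, i ≠ j → br (w i / w j) ≠ 0 := by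
    simpa using hu
  have hzl' : ∀ j ∈ l.toFinset, br (z / w j) ≠ 0 := by simpa using hzl
  have hBB : ∀ x y, x ≠ 0 → y ≠ 0 → Commute (monoT q c w x l 0 1) (monoT q c w y l 0 1) :=
    fun x y hx hy => commute_B hq hq4 hc hw hx hy hl
  have eA := off_shell (T := fun x => monoT q c w x l 0 0) (B := fun x => monoT q c w x l 0 1)
    (f := fun x y => br (q * (y / x)) / br (y / x)) (g := fun x y => -br q / br (y / x))
    (t := fun x => ∏ j ∈ l.toFinset, br (q ^ 2 * (q⁻¹ * x / w j)))
    hP (fun x => by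
      rw [hP0, (monoT_mul_vac hl hQ x).1, List.prod_toFinset _ hl])
    (fun x y hx hy hxy => by
      have h := sixVertex_AB (exchange_monoT (w := w) hq hc hw hy hx hl)
      rw [br_div_swap, neg_ne_zero] at hxy
      refine smul_right_injective _ hxy ?_
      simp only [smul_add, smul_smul, mul_div_cancel₀ _ hxy]
      rw [h]
      module)
    hBB (fun x y z hx hy hz hxy hxz hyz => by
      rw [br_div_swap, neg_ne_zero] at hxy hxz hyz
      have h := exchange_coeff_identity hq (inv_ne_zero hx) (inv_ne_zero hy) (inv_ne_zero hz)
      simp only [inv_div_inv] at h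
      exact h hxy hxz hyz)
    hw hu' subset_rfl hz hzl'
  have eD := off_shell (T := fun x => monoT q c w x l 1 1) (B := fun x => monoT q c w x l 0 1)
    (f := fun x y => br (q * (x / y)) / br (x / y)) (g := fun x y => -br q / br (x / y))
    (t := fun x => ∏ j ∈ l.toFinset, br (q⁻¹ * x / w j))
    hP (fun x => by
      rw [hP0, (monoT_mul_vac hl hQ x).2.2, List.prod_toFinset _ hl])
    (fun x y hx hy hxy => by
      have h := sixVertex_DB (exchange_monoT (w := w) hq hc hw hx hy hl)
      refine smul_right_injective _ hxy ?_
      simp only [smul_add, smul_smul, mul_div_cancel₀ _ hxy]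
      rw [← h]
      module)
    hBB (fun x y z hx hy hz hxy hxz hyz =>
      exchange_coeff_identity hq hx hy hz hxy hxz hyz)
    hw hu' subset_rfl hz hzl'
  have factor : ∀ x y : ℂ, br (q ^ 2 * (q⁻¹ * x / y)) * (br (q * (y / x)) / br (y / x)) =
      br (q⁻¹ * x / y) * (br (q * (x / y)) / br (x / y)) := fun x y => by
    rw [br_inv_mul_div, br_div_swap x y, mul_div_assoc, mul_div_assoc, ← mul_assoc (q ^ 2), sq,
      mul_inv_cancel_right₀ hq]
    ring
  rw [hPl, eA, eD]
  congr 1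
  · congr 1
    simp only [← Finset.prod_mul_distrib, factor]
  · refine Finset.sum_congr rfl fun j hj => ?_
    congr 1
    have hα : br (q ^ 2 * (q⁻¹ * w j / w j)) = br q := by
      rw [mul_div_assoc, div_self (hw j), sq]
      congr 1
      field_simp
    have hδ : br (q⁻¹ * w j / w j) = -br q := by
      rw [mul_div_assoc, div_self (hw j), mul_one, br_inv]
    simp only [← Finset.mul_prod_erase _ _ hj, hα, hδ, mul_assoc, ← Finset.prod_mul_distrib,
      factor]
    rw [br_div_swap (w j) z]
    ring

end Transfer

section Components
variable {N : ℕ} {q c : ℂ} {w : Fin N → ℂ}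

/-- The operator replacing a vector by its component with spin `x` at site `a`. -/
def siteComp (a : Fin N) (x : Fin 3) : Matrix (Fin N → Fin 3) (Fin N → Fin 3) ℂ :=
  siteHom a (Matrix.of fun _ y => if y = x then 1 else 0)

theorem comp_mul_apply (a : Fin N) (x : Fin 3) (M : Matrix (Fin N → Fin 3) (Fin N → Fin 3) ℂ)
    (σ τ : Fin N → Fin 3) : (siteComp a x * M) σ τ = M (Function.update σ a x) τ := by
  simp [siteComp, siteHom_mul_apply]

theorem ext_comp (a : Fin N) {M M' : Matrix (Fin N → Fin 3) (Fin N → Fin 3) ℂ}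
    (h : ∀ x, siteComp a x * M = siteComp a x * M') : M = M' := by
  ext σ τ
  have := congrFun (congrFun (h (σ a)) σ) τ
  simpa [comp_mul_apply] using this

theorem comp_mul_siteHom (a : Fin N) (x : Fin 3) (m : Matrix (Fin 3) (Fin 3) ℂ) :
    siteComp a x * siteHom a m = ∑ y, m x y • siteComp a y := by
  simp only [siteComp, ← map_mul, ← map_smul, ← map_sum]
  congr 1
  ext i j
  simp [Matrix.mul_apply, Matrix.sum_apply]

theorem comp_mul_monoT_cons {a : Fin N} {l : List (Fin N)} (ha : a ∉ l) (z : ℂ) (x : Fin 3)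
    (i j : Fin 2) (M : Matrix (Fin N → Fin 3) (Fin N → Fin 3) ℂ) :
    siteComp a x * (monoT q c w z (a :: l) i j * M) =
      ∑ p, ∑ y, localL q c (q⁻¹ * z / w a) i p x y • (monoT q c w z l p j * (siteComp a y * M)) := by
  rw [monoT_cons, Matrix.mul_apply, Finset.sum_mul, Finset.mul_sum]
  refine Finset.sum_congr rfl fun p _ => ?_
  rw [Matrix.map_apply, mul_assoc, ← mul_assoc, comp_mul_siteHom, Finset.sum_mul]
  refine Finset.sum_congr rfl fun y _ => ?_
  rw [smul_mul_assoc, ← mul_assoc, ← mul_assoc, siteComp, (commute_monoT ha z _ p j).eq]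

theorem comp_mul_monoT_concat {a : Fin N} {l : List (Fin N)} (ha : a ∉ l) (z : ℂ) (x : Fin 3)
    (i j : Fin 2) (M : Matrix (Fin N → Fin 3) (Fin N → Fin 3) ℂ) :
    siteComp a x * (monoT q c w z (l ++ [a]) i j * M) =
      ∑ p, ∑ y, localL q c (q⁻¹ * z / w a) p j x y • (monoT q c w z l i p * (siteComp a y * M)) := by
  rw [monoT_concat, Matrix.mul_apply, Finset.sum_mul, Finset.mul_sum]
  refine Finset.sum_congr rfl fun p _ => ?_
  rw [Matrix.map_apply, mul_assoc, ← mul_assoc, siteComp, (commute_monoT ha z _ i p).eq, ← siteComp,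
    mul_assoc, ← mul_assoc (siteComp a x), comp_mul_siteHom, Finset.sum_mul, Finset.mul_sum]
  refine Finset.sum_congr rfl fun y _ => ?_
  rw [smul_mul_assoc, mul_smul_comm]

theorem IsVac.comp_mul {a : Fin N} {l : List (Fin N)} (ha : a ∉ l)
    {Q : Matrix (Fin N → Fin 3) (Fin N → Fin 3) ℂ} (hQ : IsVac l Q) (x : Fin 3) :
    IsVac l (siteComp a x * Q) := fun j hj m h1 h2 => by
  have hja : j ≠ a := fun h => ha (h ▸ hj)
  rw [← mul_assoc, siteComp, (commute_siteHom hja m _).eq, mul_assoc, hQ j hj m h1 h2, mul_smul_comm]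

theorem comp_zero_mul_prod_cons {a : Fin N} {l : List (Fin N)} (ha : a ∉ l) (l' : List (Fin N))
    (M : Matrix (Fin N → Fin 3) (Fin N → Fin 3) ℂ) :
    siteComp a 0 * ((l'.map fun j => monoT q c w (w j) (a :: l) 0 1).prod * M) =
      (l'.map fun j => br (q ^ 2 * (q⁻¹ * w j / w a))).prod •
        ((l'.map fun j => monoT q c w (w j) l 0 1).prod * (siteComp a 0 * M)) := by
  induction l' with
  | nil => simp
  | cons b l' ih =>
    simp only [List.map_cons, List.prod_cons, mul_assoc]
    rw [comp_mul_monoT_cons ha, mul_smul]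
    simp [Fin.sum_univ_two, Fin.sum_univ_three, localL, ih]

theorem comp_zero_mul_prod_concat {a : Fin N} {l : List (Fin N)} (ha : a ∉ l)
    (l' : List (Fin N)) (M : Matrix (Fin N → Fin 3) (Fin N → Fin 3) ℂ) :
    siteComp a 0 * ((l'.map fun j => monoT q c w (w j) (l ++ [a]) 0 1).prod * M) =
      (l'.map fun j => br (q⁻¹ * w j / w a)).prod •
        ((l'.map fun j => monoT q c w (w j) l 0 1).prod * (siteComp a 0 * M)) := by
  induction l' with
  | nil => simp
  | cons b l' ih =>
    simp only [List.map_cons, List.prod_cons, mul_assoc]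
    rw [comp_mul_monoT_concat ha, mul_smul]
    simp [Fin.sum_univ_two, Fin.sum_univ_three, localL, ih]

theorem prod_B_perm (hq : q ≠ 0) (hq4 : q ^ 4 ≠ 1) (hc : c ^ 2 = br q * br (q ^ 2))
    (hw : ∀ j, w j ≠ 0) {l l₁ l₂ : List (Fin N)} (hl : l.Nodup) (h : l₁.Perm l₂) :
    (l₁.map fun j => monoT q c w (w j) l 0 1).prod =
      (l₂.map fun j => monoT q c w (w j) l 0 1).prod := by
  refine (h.map _).prod_eq' ?_
  rw [List.pairwise_map]
  exact List.pairwise_of_forall fun i j => commute_B hq hq4 hc hw (hw i) (hw j) hl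

/-- Cyclic covariance of the Bethe vector for generic inhomogeneities. -/
theorem cyclic_of_generic (hq : q ≠ 0) (hq4 : q ^ 4 ≠ 1) (hc : c ^ 2 = br q * br (q ^ 2))
    (hw : ∀ j, w j ≠ 0) {a : Fin N} {l : List (Fin N)} (hl : (a :: l).Nodup)
    {Q : Matrix (Fin N → Fin 3) (Fin N → Fin 3) ℂ} (hQ : IsVac (a :: l) Q)
    (hu : ∀ i ∈ a :: l, ∀ j ∈ a :: l, i ≠ j → br (w i / w j) ≠ 0)
    (hqu : ∀ j ∈ a :: l, br (q * w a / w j) ≠ 0)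
    (hD : IsUnit (monoT q c w (q * w a) l 1 1)) :
    (l.map fun j => br (q⁻¹ * w j / w a)).prod •
        (siteHom a (Matrix.diagonal ![-1, 1, -1]) *
          (((a :: l).map fun j => monoT q c w (w j) (a :: l) 0 1).prod * Q)) =
      (l.map fun j => br (q ^ 2 * (q⁻¹ * w j / w a))).prod •
        (((a :: l).map fun j => monoT q c w (w j) (l ++ [a]) 0 1).prod * Q) := by
  have ha : a ∉ l := (List.nodup_cons.1 hl).1
  have hl' : (l ++ [a]).Nodup := (List.perm_append_singleton a l).nodup_iff.2 hl
  have hmem : ∀ j, j ∈ l ++ [a] ↔ j ∈ a :: l := fun _ => (List.perm_append_singleton a l).mem_iff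
  have hqa : q * w a ≠ 0 := mul_ne_zero hq (hw a)
  have hQl : IsVac l Q := fun j hj => hQ j (List.mem_cons_of_mem a hj)
  have hL0 : q⁻¹ * w a / w a = q⁻¹ := by rw [mul_div_assoc, div_self (hw a), mul_one]
  have hL1 : q⁻¹ * (q * w a) / w a = 1 := by
    rw [inv_mul_cancel_left₀ hq, div_self (hw a)]
  have tΨ := transfer_mul_bethe hq hq4 hc hw hl hQ hu hqa hqu
  have tΨ' := transfer_mul_bethe hq hq4 hc hw hl' (fun j hj => hQ j ((hmem j).1 hj))
    (fun i hi j hj => hu i ((hmem i).1 hi) j ((hmem j).1 hj)) hqa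
    (fun j hj => hqu j ((hmem j).1 hj))
  rw [prod_B_perm hq hq4 hc hw hl' (List.perm_append_singleton a l)] at tΨ'
  have tX := transfer_mul_bethe hq hq4 hc hw (List.nodup_cons.1 hl).2 (hQl.comp_mul ha 0)
    (fun i hi j hj => hu i (List.mem_cons_of_mem a hi) j (List.mem_cons_of_mem a hj)) (hw a)
    (fun j hj => hu a List.mem_cons_self j (List.mem_cons_of_mem a hj) fun h => ha (h ▸ hj))
  have Φ0 := comp_zero_mul_prod_cons (q := q) (c := c) (w := w) ha l Q
  have Φ0' := comp_zero_mul_prod_concat (q := q) (c := c) (w := w) ha l Q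
  set κ := (l.map fun j => br (q⁻¹ * w j / w a)).prod
  set κ' := (l.map fun j => br (q ^ 2 * (q⁻¹ * w j / w a))).prod
  set X := (l.map fun j => monoT q c w (w j) l 0 1).prod * (siteComp a 0 * Q)
  rw [List.map_cons, List.prod_cons, mul_assoc] at tΨ tΨ' ⊢
  rw [List.map_cons, List.prod_cons, mul_assoc]
  set Φ := (l.map fun j => monoT q c w (w j) (a :: l) 0 1).prod * Q
  set Φ' := (l.map fun j => monoT q c w (w j) (l ++ [a]) 0 1).prod * Q
  have Ψ0 : siteComp a 0 * (monoT q c w (w a) (a :: l) 0 1 * Φ) =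
      (br q * κ') • (monoT q c w (w a) l 0 1 * X) := by
    rw [comp_mul_monoT_cons ha, hL0]
    simp [Fin.sum_univ_two, Fin.sum_univ_three, localL, Φ0, smul_smul, sq, hq]
  have Ψ0' : siteComp a 0 * (monoT q c w (w a) (l ++ [a]) 0 1 * Φ') =
      (-br q * κ) • (monoT q c w (w a) l 0 1 * X) := by
    rw [comp_mul_monoT_concat ha, hL0]
    simp [Fin.sum_univ_two, Fin.sum_univ_three, localL, Φ0', smul_smul, br_inv]
  have Ψ1 : siteComp a 1 * (monoT q c w (w a) (a :: l) 0 1 * Φ) =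
      (c * κ') • (monoT q c w (w a) l 1 1 * X) := by
    rw [comp_mul_monoT_cons ha, hL0]
    simp [Fin.sum_univ_two, Fin.sum_univ_three, localL, Φ0, smul_smul, hq, br_one]
  have Ψ1' : siteComp a 1 * (monoT q c w (w a) (l ++ [a]) 0 1 * Φ') =
      (c * κ) • (monoT q c w (w a) l 1 1 * X) := by
    rw [comp_mul_monoT_concat ha, hL0]
    simp [Fin.sum_univ_two, Fin.sum_univ_three, localL, Φ0', smul_smul, hq, br_one, tX]
  set Ψ := monoT q c w (w a) (a :: l) 0 1 * Φ
  set Ψ' := monoT q c w (w a) (l ++ [a]) 0 1 * Φ'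
  have t2 := congrArg (siteComp a 2 * ·) tΨ
  have t2' := congrArg (siteComp a 2 * ·) tΨ'
  simp only [comp_mul_monoT_cons ha, comp_mul_monoT_concat ha, hL1] at t2 t2'
  simp [Fin.sum_univ_two, Fin.sum_univ_three, localL, br_one, Ψ1, Ψ1'] at t2 t2'
  have hq2 : br (q ^ 2) ≠ 0 := by
    rw [Ne, br_eq_zero_iff (pow_ne_zero 2 hq), ← pow_mul]
    exact hq4
  have e2 : -κ • (siteComp a 2 * Ψ) = κ' • (siteComp a 2 * Ψ') := by
    refine hD.mul_right_injective (smul_right_injective _ hq2 ?_)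
    simp only [mul_smul_comm]
    linear_combination (norm := module) κ • t2 + κ' • t2'
  refine ext_comp a fun x => ?_
  rw [mul_smul_comm, mul_smul_comm, ← mul_assoc, comp_mul_siteHom]
  fin_cases x
  · simp [Fin.sum_univ_three, Ψ0, Ψ0', smul_smul]
    congr 1
    ring
  · simp [Fin.sum_univ_three, Ψ1, Ψ1', smul_smul]
    congr 1
    ring
  · simpa [Fin.sum_univ_three] using e2

end Components

section Rotation
variable {N : ℕ} {q c : ℂ}

theorem bethe_apply (w : Fin N → ℂ) (σ : Fin N → Fin 3) :
    bethe q c w σ = ((List.finRange N).map fun j =>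
      monoT q c w (w j) (List.finRange N).reverse 0 1).prod σ fun _ => 0 := by
  have hB : ∀ z, Bop q c w z = monoT q c w z (List.finRange N).reverse 0 1 := fun z => by
    ext σ τ
    exact monodromy_eq_monoT z 0 1 σ τ
  simp only [bethe, hB, Matrix.mulVec, dotProduct, vac, mul_ite, mul_one, mul_zero,
    Finset.sum_ite_eq', Finset.mem_univ, if_true]

/-- Relabelling the sites by a permutation. -/
def permSites (e : Equiv.Perm (Fin N)) :
    Matrix (Fin N → Fin 3) (Fin N → Fin 3) ℂ ≃ₐ[ℂ] Matrix (Fin N → Fin 3) (Fin N → Fin 3) ℂ :=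
  Matrix.reindexAlgEquiv ℂ ℂ (Equiv.arrowCongr e (Equiv.refl (Fin 3))).symm

theorem permSites_apply (e : Equiv.Perm (Fin N)) (M : Matrix (Fin N → Fin 3) (Fin N → Fin 3) ℂ)
    (σ τ : Fin N → Fin 3) :
    permSites e M σ τ = M (fun j => σ (e.symm j)) (fun j => τ (e.symm j)) := rfl

theorem permSites_siteHom (e : Equiv.Perm (Fin N)) (j : Fin N) (m : Matrix (Fin 3) (Fin 3) ℂ) :
    permSites e (siteHom j m) = siteHom (e.symm j) m := by
  ext σ τ
  rw [permSites_apply, siteHom_apply, siteHom_apply]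
  congr 2
  refine propext ⟨fun h k hk => ?_, fun h k hk => h _ (e.symm.injective.ne hk)⟩
  simpa using h (e k) fun hk' => hk (by simp [← hk'])

theorem permSites_monoT (e : Equiv.Perm (Fin N)) (w : Fin N → ℂ) (z : ℂ) (l : List (Fin N))
    (i j : Fin 2) :
    permSites e (monoT q c (fun j => w (e.symm j)) z l i j) =
      monoT q c w z (l.map e.symm) i j := by
  have h : (permSites e).toAlgHom.mapMatrix (monoT q c (fun j => w (e.symm j)) z l) =
      monoT q c w z (l.map e.symm) := by
    rw [monoT, monoT, map_list_prod, List.map_map, List.map_map]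
    congr 2
    funext k
    ext i j : 1
    exact permSites_siteHom e k _
  rw [← h]
  rfl

theorem bethe_permSites (e : Equiv.Perm (Fin N)) (w : Fin N → ℂ) (σ : Fin N → Fin 3) :
    bethe q c (fun j => w (e.symm j)) σ = (((List.finRange N).map e.symm).map fun j =>
      monoT q c w (w j) ((List.finRange N).reverse.map e.symm) 0 1).prod
        (fun j => σ (e j)) fun _ => 0 := by
  rw [bethe_apply]
  simp only [List.map_map, Function.comp_def, ← permSites_monoT]
  rw [← Function.comp_def (permSites e), ← List.map_map, ← map_list_prod, permSites_apply]
  simp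

theorem finRange_map_finRotate_symm (n : ℕ) :
    (List.finRange (n + 1)).map (finRotate (n + 1)).symm =
      Fin.last n :: (List.finRange n).map Fin.castSucc := by
  rw [List.finRange_succ, List.map_cons, List.map_map]
  refine congrArg₂ List.cons ?_ ?_
  · rw [Equiv.symm_apply_eq, finRotate_last]
  · refine List.map_congr_left fun j _ => ?_
    rw [Function.comp_apply, Equiv.symm_apply_eq, finRotate_apply, Fin.coeSucc_eq_succ]

theorem reverse_finRange_succ (n : ℕ) :
    (List.finRange (n + 1)).reverse =
      Fin.last n :: ((List.finRange n).map Fin.castSucc).reverse := by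
  rw [List.finRange_succ_last, List.reverse_append]
  rfl

theorem isVac_single (l : List (Fin N)) :
    IsVac l (Matrix.single (fun _ => 0) (fun _ => 0) 1) := by
  intro j _ m h₁ h₂
  ext σ τ
  rw [siteHom_mul_apply, Fin.sum_univ_three, Matrix.smul_apply, smul_eq_mul]
  have hz : ∀ y : Fin 3, y ≠ 0 → ∀ f : Fin N → Fin 3, (fun _ => (0 : Fin 3)) ≠
      Function.update f j y := fun y hy f h => hy (by simpa using (congrFun h j).symm)
  rw [Matrix.single_apply_of_row_ne (hz 1 (by decide) σ),
    Matrix.single_apply_of_row_ne (hz 2 (by decide) σ)]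
  simp only [mul_zero, add_zero]
  rcases eq_or_ne (σ j) 0 with h | h
  · rw [h, ← h, Function.update_eq_self, h]
  · have h3 : σ j = 1 ∨ σ j = 2 := by
      revert h
      generalize σ j = x
      revert x
      decide
    have hne : (fun _ => (0 : Fin 3)) ≠ σ := fun h' => h (by rw [← h'])
    rw [Matrix.single_apply_of_row_ne hne, mul_zero]
    rcases h3 with h3 | h3 <;> simp [h3, h₁, h₂]

theorem cyclic_bethe_of_generic (hq : q ≠ 0) (hq4 : q ^ 4 ≠ 1)
    (hc : c ^ 2 = br q * br (q ^ 2)) {n : ℕ} {w : Fin (n + 1) → ℂ} (hw : ∀ j, w j ≠ 0)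
    (hu : ∀ i j, i ≠ j → br (w i / w j) ≠ 0) (hqu : ∀ j, br (q * w (Fin.last n) / w j) ≠ 0)
    (hD : IsUnit (monoT q c w (q * w (Fin.last n))
      ((List.finRange n).map Fin.castSucc).reverse 1 1)) (σ : Fin (n + 1) → Fin 3) :
    (∏ j : Fin n, br (q⁻¹ * w j.castSucc / w (Fin.last n))) *
        ((![-1, 1, -1] : Fin 3 → ℂ) (σ 0) * bethe q c w fun j => σ (finRotate (n + 1) j)) =
      (∏ j : Fin n, br (q ^ 2 * (q⁻¹ * w j.castSucc / w (Fin.last n)))) *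
        bethe q c (fun j => w ((finRotate (n + 1)).symm j)) σ := by
  have hmap := finRange_map_finRotate_symm n
  have hrev := reverse_finRange_succ n
  have hnd : (List.finRange (n + 1)).reverse.Nodup :=
    List.nodup_reverse.2 (List.nodup_finRange _)
  have hrev' : (List.finRange (n + 1)).reverse.map (finRotate (n + 1)).symm =
      ((List.finRange n).map Fin.castSucc).reverse ++ [Fin.last n] := by
    rw [List.map_reverse, hmap, List.reverse_cons]
  have hnd' : (((List.finRange n).map Fin.castSucc).reverse ++ [Fin.last n]).Nodup := by
    rw [← hrev']
    exact hnd.map (finRotate (n + 1)).symm.injective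
  rw [bethe_apply, bethe_permSites, hrev', hmap, hrev]
  rw [hrev] at hnd
  rw [prod_B_perm hq hq4 hc hw hnd
      (l₁ := List.finRange (n + 1)) (l₂ := (List.finRange (n + 1)).reverse)
      (List.reverse_perm _).symm, hrev,
    prod_B_perm hq hq4 hc hw hnd'
      (l₁ := Fin.last n :: (List.finRange n).map Fin.castSucc)
      (l₂ := Fin.last n :: ((List.finRange n).map Fin.castSucc).reverse)
      ((List.reverse_perm _).symm.cons _)]
  have key := cyclic_of_generic hq hq4 hc hw hnd (isVac_single _)
    (fun i _ j _ => hu i j) (fun j _ => hqu j) hD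
  have e := congrFun (congrFun key fun j => σ (finRotate (n + 1) j)) fun _ => 0
  have hprod : ∀ f : Fin (n + 1) → ℂ,
      (((List.finRange n).map Fin.castSucc).reverse.map f).prod = ∏ j : Fin n, f j.castSucc :=
    fun f => by
      rw [List.map_reverse, List.prod_reverse, List.map_map, ← List.ofFn_eq_map, List.prod_ofFn]
      rfl
  simp only [hprod, Matrix.smul_apply, smul_eq_mul, siteHom_mul_apply, finRotate_last,
    Matrix.diagonal_apply, ite_mul, zero_mul, Finset.sum_ite_eq, Finset.mem_univ, if_true,
    Matrix.mul_single_apply_same, mul_one] at e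
  have hup : Function.update (fun j => σ (finRotate (n + 1) j)) (Fin.last n) (σ 0) =
      fun j => σ (finRotate (n + 1) j) := by
    conv_lhs => rw [← finRotate_last, Function.update_eq_self]
  rw [hup] at e
  exact e

end Rotation

section Analytic
variable {N : ℕ} {q c : ℂ}

theorem DifferentiableAt.br {f : ℂ → ℂ} {t : ℂ} (hf : DifferentiableAt ℂ f t) (h0 : f t ≠ 0) :
    DifferentiableAt ℂ (fun t => br (f t)) t :=
  hf.sub (hf.inv h0)

theorem differentiableAt_list_prod {ι n : Type*} [Fintype n] [DecidableEq n] {t : ℂ}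
    {F : ι → ℂ → Matrix n n ℂ} (l : List ι)
    (h : ∀ k ∈ l, ∀ a b, DifferentiableAt ℂ (fun t => F k t a b) t) (a b : n) :
    DifferentiableAt ℂ (fun t => (l.map fun k => F k t).prod a b) t := by
  induction l generalizing a with
  | nil => simp
  | cons k l ih =>
    simp only [List.map_cons, List.prod_cons, Matrix.mul_apply]
    exact DifferentiableAt.fun_sum fun i _ => (h k List.mem_cons_self a i).mul
      (ih (fun k hk => h k (List.mem_cons_of_mem _ hk)) i)

theorem differentiableAt_R12 (hq : q ≠ 0) {f : ℂ → ℂ} {t : ℂ} (hf : DifferentiableAt ℂ f t)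
    (h0 : f t ≠ 0) (a b : Fin 2 × Fin 3) : DifferentiableAt ℂ (fun t => R12 q c (f t) a b) t := by
  have h₁ := hf.br h0
  have h₂ := (hf.const_mul q).br (mul_ne_zero hq h0)
  have h₃ := (hf.const_mul (q ^ 2)).br (mul_ne_zero (pow_ne_zero 2 hq) h0)
  obtain ⟨i, x⟩ := a
  obtain ⟨j, y⟩ := b
  simp only [R12_eq_localL]
  fin_cases i <;> fin_cases j <;> fin_cases x <;> fin_cases y <;> simp [localL, h₁, h₂, h₃]

theorem differentiableAt_bethe (hq : q ≠ 0) {w : ℂ → Fin N → ℂ} {t : ℂ}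
    (hw : ∀ j, DifferentiableAt ℂ (fun t => w t j) t) (h0 : ∀ j, w t j ≠ 0)
    (σ : Fin N → Fin 3) : DifferentiableAt ℂ (fun t => bethe q c (w t) σ) t := by
  simp only [bethe, Matrix.mulVec, dotProduct]
  refine DifferentiableAt.fun_sum fun τ _ => DifferentiableAt.mul_const
    (differentiableAt_list_prod _ (fun k _ a b => ?_) σ τ) _
  refine differentiableAt_list_prod _ (fun j _ a b => ?_) _ _
  simp only [R12at, Matrix.of_apply]
  exact (differentiableAt_R12 hq (((hw k).const_mul _).fun_div (hw j) (h0 j))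
    (by have := h0 k; have := h0 j; positivity) _ _).mul_const _

end Analytic

section Asymptotics
open Filter Topology Bornology
variable {N : ℕ} {q c : ℂ} {α : Type*} {F : Filter α}

theorem tendsto_inv_mul_br {u : α → ℂ} (hu : Tendsto u F (cobounded ℂ)) (a : ℂ) :
    Tendsto (fun t => (u t)⁻¹ * br (a * u t)) F (𝓝 a) := by
  have hi : Tendsto (fun t => (u t)⁻¹) F (𝓝 0) := tendsto_inv₀_cobounded.comp hu
  have h : Tendsto (fun t => a - a⁻¹ * ((u t)⁻¹ * (u t)⁻¹)) F (𝓝 a) := by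
    simpa using tendsto_const_nhds.sub ((hi.mul hi).const_mul a⁻¹)
  refine h.congr' ?_
  filter_upwards [hu.eventually_ne_cobounded 0] with t ht
  rw [br, mul_inv]
  field_simp

/-- The leading term of `localL q c z` as `z → ∞`. -/
def localLim (q : ℂ) : Matrix (Fin 2) (Fin 2) (Matrix (Fin 3) (Fin 3) ℂ) :=
  !![Matrix.diagonal ![q ^ 2, q, 1], 0; 0, Matrix.diagonal ![1, q, q ^ 2]]

theorem tendsto_inv_smul_localL {u : α → ℂ} (hu : Tendsto u F (cobounded ℂ)) (i j : Fin 2)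
    (x y : Fin 3) :
    Tendsto (fun t => (u t)⁻¹ * localL q c (u t) i j x y) F (𝓝 (localLim q i j x y)) := by
  have hi : Tendsto (fun t => (u t)⁻¹) F (𝓝 0) := tendsto_inv₀_cobounded.comp hu
  have hc : Tendsto (fun t => (u t)⁻¹ * c) F (𝓝 0) := by simpa using hi.mul_const c
  have h₁ : Tendsto (fun t => (u t)⁻¹ * br (u t)) F (𝓝 1) := by
    simpa using tendsto_inv_mul_br hu 1
  have h₂ := tendsto_inv_mul_br hu q
  have h₃ := tendsto_inv_mul_br hu (q ^ 2)
  fin_cases i <;> fin_cases j <;> fin_cases x <;> fin_cases y <;>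
    simp [localL, localLim, h₁, h₂, h₃, hc, tendsto_const_nhds]

theorem list_prod_map_smul {ι A : Type*} [Semiring A] [Algebra ℂ A] (k : ι → ℂ) (X : ι → A)
    (l : List ι) :
    (l.map fun j => k j • X j).prod = (l.map k).prod • (l.map X).prod := by
  induction l with
  | nil => simp
  | cons a l ih =>
    rw [List.map_cons, List.prod_cons, ih, smul_mul_smul_comm]
    simp only [List.map_cons, List.prod_cons]

theorem isUnit_list_prod_localLim (hq : q ≠ 0) (l : List (Fin N)) :
    IsUnit ((l.map fun j => (localLim q).map (siteHom j)).prod 1 1) := by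
  induction l with
  | nil => simp
  | cons a l ih =>
    rw [List.map_cons, List.prod_cons, Matrix.mul_apply, Fin.sum_univ_two]
    have h : IsUnit (Matrix.diagonal ![1, q, q ^ 2]) := by
      rw [Matrix.isUnit_diagonal, Pi.isUnit_iff]
      intro i
      fin_cases i <;> simp [hq]
    simpa [localLim] using (h.map (siteHom a)).mul ih

theorem eventually_isUnit_monoT (hq : q ≠ 0) {w : α → Fin N → ℂ} {z : α → ℂ} (l : List (Fin N))
    (hu : ∀ j ∈ l, Tendsto (fun t => q⁻¹ * z t / w t j) F (cobounded ℂ)) :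
    ∀ᶠ t in F, IsUnit (monoT q c (w t) (z t) l 1 1) := by
  have hlim : Tendsto (fun t => (l.map fun j => (q⁻¹ * z t / w t j)⁻¹ •
      (localL q c (q⁻¹ * z t / w t j)).map (siteHom j)).prod) F
      (𝓝 (l.map fun j => (localLim q).map (siteHom j)).prod) := by
    refine tendsto_list_prod l fun j hj => ?_
    refine tendsto_pi_nhds.2 fun i => tendsto_pi_nhds.2 fun k => tendsto_pi_nhds.2 fun σ =>
      tendsto_pi_nhds.2 fun τ => ?_
    have h := (tendsto_inv_smul_localL (q := q) (c := c) (hu j hj) i k (σ j) (τ j)).mul_const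
      (if ∀ k, k ≠ j → σ k = τ k then (1 : ℂ) else 0)
    simp only [mul_assoc] at h
    exact h
  have hdet := (isUnit_list_prod_localLim hq l)
  rw [Matrix.isUnit_iff_isUnit_det, isUnit_iff_ne_zero] at hdet
  have hcont : Continuous fun M : Matrix (Fin 2) (Fin 2)
      (Matrix (Fin N → Fin 3) (Fin N → Fin 3) ℂ) => (M 1 1).det :=
    (continuous_apply_apply (1 : Fin 2) (1 : Fin 2)).matrix_det
  filter_upwards [((hcont.tendsto _).comp hlim).eventually_ne hdet] with t ht
  rw [Function.comp_apply, list_prod_map_smul, Matrix.smul_apply, Matrix.det_smul] at ht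
  rw [Matrix.isUnit_iff_isUnit_det, isUnit_iff_ne_zero]
  exact right_ne_zero_of_mul ht

theorem eventually_br_ne_zero {u : α → ℂ} (hu : Tendsto u F (cobounded ℂ)) :
    ∀ᶠ t in F, br (u t) ≠ 0 := by
  filter_upwards [hu.eventually_ne_cobounded 0, hu.eventually_ne_cobounded 1,
    hu.eventually_ne_cobounded (-1)] with t h0 h1 h2
  rw [Ne, br_eq_zero_iff h0, sq_eq_one_iff]
  exact not_or.2 ⟨h1, h2⟩

theorem tendsto_curve {k : ℂ} (hk : k ≠ 0) {w : Fin N → ℂ} (hw : ∀ j, w j ≠ 0) {i j : Fin N}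
    (hij : j < i) :
    Tendsto (fun t => k * (w i * t ^ (i : ℕ)) / (w j * t ^ (j : ℕ))) (cobounded ℂ)
      (cobounded ℂ) := by
  have hlt : (j : ℕ) < i := hij
  have h : Tendsto (fun t : ℂ => k * w i / w j * t ^ ((i : ℕ) - j)) (cobounded ℂ)
      (cobounded ℂ) :=
    (Filter.tendsto_mul_left_cobounded (div_ne_zero (mul_ne_zero hk (hw i)) (hw j))).comp
      (tendsto_pow_cobounded_cobounded (by omega))
  refine h.congr' ?_
  filter_upwards [eventually_ne_cobounded (0 : ℂ)] with t ht
  rw [pow_sub₀ t ht hlt.le]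
  have := hw j
  field_simp

end Asymptotics

section Continuation
open Filter Topology Bornology
variable {q c : ℂ}

theorem eq_zero_of_eventually_cobounded {f : ℂ → ℂ} (hf : ∀ t ≠ 0, DifferentiableAt ℂ f t)
    (h : ∀ᶠ t in cobounded ℂ, f t = 0) {t : ℂ} (ht : t ≠ 0) : f t = 0 := by
  obtain ⟨r, -, hr⟩ := (hasBasis_cobounded_norm (E := ℂ)).eventually_iff.1 h
  have hz : r < ‖((|r| + 1 : ℝ) : ℂ)‖ := by
    rw [Complex.norm_real, Real.norm_eq_abs]
    exact lt_of_lt_of_le (by linarith [le_abs_self r]) (le_abs_self _)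
  have hz0 : ((|r| + 1 : ℝ) : ℂ) ≠ 0 := by
    rw [Complex.ofReal_ne_zero]
    positivity
  have hanal : AnalyticOnNhd ℂ f {0}ᶜ :=
    DifferentiableOn.analyticOnNhd (fun t ht => (hf t ht).differentiableWithinAt)
      isOpen_compl_singleton
  refine hanal.eqOn_zero_of_preconnected_of_eventuallyEq_zero
    (isConnected_compl_singleton_of_one_lt_rank (by simp) 0).isPreconnected hz0 ?_ ht
  filter_upwards [(isOpen_lt continuous_const continuous_norm).mem_nhds hz] with z hz
  exact hr (le_of_lt hz)

theorem cyclic_bethe (hq : q ≠ 0) (hq4 : q ^ 4 ≠ 1) (hc : c ^ 2 = br q * br (q ^ 2)) {n : ℕ}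
    {w : Fin (n + 1) → ℂ} (hw : ∀ j, w j ≠ 0) (σ : Fin (n + 1) → Fin 3) :
    (∏ j : Fin n, br (q⁻¹ * w j.castSucc / w (Fin.last n))) *
        ((![-1, 1, -1] : Fin 3 → ℂ) (σ 0) * bethe q c w fun j => σ (finRotate (n + 1) j)) =
      (∏ j : Fin n, br (q ^ 2 * (q⁻¹ * w j.castSucc / w (Fin.last n)))) *
        bethe q c (fun j => w ((finRotate (n + 1)).symm j)) σ := by
  let v : ℂ → Fin (n + 1) → ℂ := fun t j => w j * t ^ (j : ℕ)
  have hv0 : ∀ t ≠ 0, ∀ j, v t j ≠ 0 := fun t ht j => mul_ne_zero (hw j) (pow_ne_zero _ ht)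
  have hv : ∀ t j, DifferentiableAt ℂ (fun t => v t j) t := fun t j =>
    (differentiableAt_id.pow _).const_mul _
  have hgen : ∀ᶠ t in cobounded ℂ,
      (∏ j : Fin n, br (q⁻¹ * v t j.castSucc / v t (Fin.last n))) *
          ((![-1, 1, -1] : Fin 3 → ℂ) (σ 0) *
            bethe q c (v t) fun j => σ (finRotate (n + 1) j)) -
        (∏ j : Fin n, br (q ^ 2 * (q⁻¹ * v t j.castSucc / v t (Fin.last n)))) *
          bethe q c (fun j => v t ((finRotate (n + 1)).symm j)) σ = 0 := by
    have hu : ∀ᶠ t in cobounded ℂ, ∀ i j, i ≠ j → br (v t i / v t j) ≠ 0 := by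
      simp only [eventually_all]
      intro i j hij
      have h : ∀ i j : Fin (n + 1), j < i → ∀ᶠ t in cobounded ℂ, br (v t i / v t j) ≠ 0 :=
        fun i j hij => by
          simpa using eventually_br_ne_zero (tendsto_curve one_ne_zero hw hij)
      rcases lt_or_gt_of_ne hij with hij | hij
      · filter_upwards [h j i hij] with t ht
        rwa [br_div_swap, neg_ne_zero]
      · exact h i j hij
    have hqu : ∀ᶠ t in cobounded ℂ, ∀ j, br (q * v t (Fin.last n) / v t j) ≠ 0 := by
      rw [eventually_all]
      intro j
      rcases eq_or_ne j (Fin.last n) with rfl | hj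
      · filter_upwards [eventually_ne_cobounded 0] with t ht
        rw [mul_div_cancel_right₀ _ (hv0 t ht _), Ne, br_eq_zero_iff hq]
        intro h
        exact hq4 (by rw [show q ^ 4 = (q ^ 2) ^ 2 by ring, h, one_pow])
      · exact eventually_br_ne_zero (tendsto_curve hq hw (Fin.lt_last_iff_ne_last.2 hj))
    have hD := eventually_isUnit_monoT (c := c) hq (F := cobounded ℂ) (w := v)
      (z := fun t => q * v t (Fin.last n)) ((List.finRange n).map Fin.castSucc).reverse
      (fun j hj => by
        obtain ⟨i, -, rfl⟩ := List.mem_map.1 (List.mem_reverse.1 hj)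
        simp only [inv_mul_cancel_left₀ hq]
        simpa [v] using tendsto_curve one_ne_zero hw (Fin.castSucc_lt_last i))
    filter_upwards [hu, hqu, hD, eventually_ne_cobounded 0] with t hu hqu hD ht
    rw [sub_eq_zero]
    exact cyclic_bethe_of_generic hq hq4 hc (hv0 t ht) hu hqu hD σ
  have hdiff : ∀ t ≠ 0, DifferentiableAt ℂ (fun t =>
      (∏ j : Fin n, br (q⁻¹ * v t j.castSucc / v t (Fin.last n))) *
          ((![-1, 1, -1] : Fin 3 → ℂ) (σ 0) *
            bethe q c (v t) fun j => σ (finRotate (n + 1) j)) -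
        (∏ j : Fin n, br (q ^ 2 * (q⁻¹ * v t j.castSucc / v t (Fin.last n)))) *
          bethe q c (fun j => v t ((finRotate (n + 1)).symm j)) σ) t := fun t ht => by
    have h0 := hv0 t ht
    have hr : ∀ j : Fin n,
        DifferentiableAt ℂ (fun t => q⁻¹ * v t j.castSucc / v t (Fin.last n)) t := fun j =>
      ((hv t _).const_mul _).fun_div (hv t _) (h0 _)
    have hr0 : ∀ j : Fin n, q⁻¹ * v t j.castSucc / v t (Fin.last n) ≠ 0 := fun j =>
      div_ne_zero (mul_ne_zero (inv_ne_zero hq) (h0 _)) (h0 _)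
    refine ((DifferentiableAt.fun_finsetProd fun j _ => (hr j).br (hr0 j)).mul
      ((differentiableAt_bethe hq (hv t) h0 _).const_mul _)).sub
      ((DifferentiableAt.fun_finsetProd fun j _ => ((hr j).const_mul (q ^ 2)).br
        (mul_ne_zero (pow_ne_zero 2 hq) (hr0 j))).mul
        (differentiableAt_bethe hq (fun j => hv t _) (fun j => h0 _) _))
  have h1 := eq_zero_of_eventually_cobounded hdiff hgen one_ne_zero
  simpa [v, sub_eq_zero] using h1

end Continuation

section Translation

theorem Sprime_mulVec {n : ℕ} (d : Fin 3 → ℂ) (v : (Fin (n + 1) → Fin 3) → ℂ)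
    (σ : Fin (n + 1) → Fin 3) :
    (Sprime (n + 1) d *ᵥ v) σ = d (σ 0) * v fun j => σ (finRotate (n + 1) j) := by
  have h : ∏ j : Fin (n + 1), (if (finRotate (n + 1) j : Fin (n + 1)).val = 0 then
      d (σ (finRotate (n + 1) j)) else 1) = d (σ 0) := by
    rw [Equiv.prod_comp (finRotate (n + 1)) fun j => if j.val = 0 then d (σ j) else 1]
    simp only [Fin.val_eq_zero_iff, Finset.prod_ite_eq', Finset.mem_univ, if_true]
  simp only [Sprime, Matrix.mulVec, dotProduct, Matrix.of_apply, ite_mul, zero_mul,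
    Finset.sum_ite_eq', Finset.mem_univ, if_true, h]

theorem prod_pairs_eq {M : Type*} [CommMonoid M] {N : ℕ} (f : Fin N → Fin N → M) :
    ∏ p ∈ Finset.univ.filter (fun p : Fin N × Fin N => p.1 < p.2), f p.1 p.2 =
      ∏ i : Fin N, ∏ j : Fin N, if i < j then f i j else 1 := by
  rw [Finset.prod_filter, Fintype.prod_prod_type]

theorem prod_pairs_castSucc {M : Type*} [CommMonoid M] {n : ℕ}
    (f : Fin (n + 1) → Fin (n + 1) → M) :
    ∏ p ∈ Finset.univ.filter (fun p : Fin (n + 1) × Fin (n + 1) => p.1 < p.2), f p.1 p.2 =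
      (∏ p ∈ Finset.univ.filter (fun p : Fin n × Fin n => p.1 < p.2),
        f p.1.castSucc p.2.castSucc) * ∏ j : Fin n, f j.castSucc (Fin.last n) := by
  rw [prod_pairs_eq, prod_pairs_eq fun i j : Fin n => f i.castSucc j.castSucc]
  simp [Fin.prod_univ_castSucc, Finset.prod_mul_distrib, Fin.castSucc_lt_last,
    (Fin.le_last _).not_gt]

theorem prod_pairs_succ {M : Type*} [CommMonoid M] {n : ℕ}
    (f : Fin (n + 1) → Fin (n + 1) → M) :
    ∏ p ∈ Finset.univ.filter (fun p : Fin (n + 1) × Fin (n + 1) => p.1 < p.2), f p.1 p.2 =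
      (∏ p ∈ Finset.univ.filter (fun p : Fin n × Fin n => p.1 < p.2),
        f p.1.succ p.2.succ) * ∏ j : Fin n, f 0 j.succ := by
  rw [prod_pairs_eq, prod_pairs_eq fun i j : Fin n => f i.succ j.succ, mul_comm]
  simp [Fin.prod_univ_succ]

theorem finRotate_symm_zero (n : ℕ) : (finRotate (n + 1)).symm 0 = Fin.last n := by
  rw [Equiv.symm_apply_eq, finRotate_last]

theorem finRotate_symm_succ {n : ℕ} (j : Fin n) :
    (finRotate (n + 1)).symm j.succ = j.castSucc := by
  rw [Equiv.symm_apply_eq, finRotate_apply, Fin.coeSucc_eq_succ]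

end Translation

/-- Cyclic covariance of the renormalised Bethe vector:
`S' |Ψ̃(w₁,…,w_N)⟩ = (−1)^{N+1} |Ψ̃(w_N,w₁,…,w_{N−1})⟩` (twist angle φ = π). -/
theorem stmt12 (q c : ℂ) (hq : q ≠ 0) (hq4 : q^4 ≠ 1) (hc : c^2 = br q * br (q^2))
    (N : ℕ) (hN : 2 ≤ N) (w : Fin N → ℂ) (hw : ∀ j, w j ≠ 0)
    (hgen : ∀ j k : Fin N, j ≠ k → q * w j / w k ≠ 1 ∧ q * w j / w k ≠ -1) :
    (Sprime N ![-1, 1, -1]).mulVec (betheTilde q c w) =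
      ((-1 : ℂ)^(N+1)) • betheTilde q c (fun j => w ((finRotate N).symm j)) := by
  obtain ⟨n, rfl⟩ : ∃ n, N = n + 1 := ⟨N - 1, by omega⟩
  have hne : ∀ j k, j ≠ k → br (q * w j / w k) ≠ 0 := fun j k hjk => by
    rw [Ne, br_eq_zero_iff (div_ne_zero (mul_ne_zero hq (hw j)) (hw k)), sq_eq_one_iff]
    exact not_or.2 (hgen j k hjk)
  funext σ
  have key := cyclic_bethe hq hq4 hc hw σ
  have hκ : ∏ j : Fin n, br (q⁻¹ * w j.castSucc / w (Fin.last n)) =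
      (-1) ^ n * ∏ j : Fin n, br (q * w (Fin.last n) / w j.castSucc) := by
    simp [br_inv_mul_div, Finset.prod_neg]
  have hκ' : ∀ j : Fin n, q ^ 2 * (q⁻¹ * w j.castSucc / w (Fin.last n)) =
      q * w j.castSucc / w (Fin.last n) := fun j => by field_simp
  have h₁ : ∏ j : Fin n, br (q * w j.castSucc / w (Fin.last n)) ≠ 0 :=
    Finset.prod_ne_zero_iff.2 fun j _ => hne _ _ (Fin.castSucc_lt_last j).ne
  have h₂ : ∏ j : Fin n, br (q * w (Fin.last n) / w j.castSucc) ≠ 0 :=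
    Finset.prod_ne_zero_iff.2 fun j _ => hne _ _ (Fin.castSucc_lt_last j).ne'
  have hsign : (-1 : ℂ) ^ n * (-1) ^ n = 1 := by rw [← mul_pow]; simp
  simp only [hκ, hκ'] at key
  simp only [Sprime_mulVec, betheTilde, Pi.smul_apply, smul_eq_mul]
  rw [prod_pairs_castSucc fun i j => br (q * w i / w j),
    prod_pairs_succ fun i j => br (q * w ((finRotate (n + 1)).symm i) /
      w ((finRotate (n + 1)).symm j))]
  simp only [finRotate_symm_zero, finRotate_symm_succ, mul_inv]
  generalize (∏ j : Fin n, br (q * w j.castSucc / w (Fin.last n))) = X at *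
  generalize (∏ j : Fin n, br (q * w (Fin.last n) / w j.castSucc)) = Y at *
  rw [pow_succ (-1 : ℂ) (n + 1), pow_succ (-1 : ℂ) n]
  generalize (-1 : ℂ) ^ n = s at *
  generalize bethe q c (fun j => w ((finRotate (n + 1)).symm j)) σ = b' at *
  generalize (bethe q c w fun j => σ (finRotate (n + 1) j)) = b at *
  generalize (![-1, 1, -1] : Fin 3 → ℂ) (σ 0) = d at *
  have h : d * b * X⁻¹ = s * b' * Y⁻¹ := by
    field_simp
    linear_combination s * key - d * b * Y * hsign
  linear_combination (c ^ (n + 1))⁻¹ *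
    (∏ p : Fin n × Fin n with p.1 < p.2, br (q * w p.1.castSucc / w p.2.castSucc))⁻¹ * h

end
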